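/- In the preprojective algebra Π(E_7), the element z_8 = −a_1a_2a_3x_6a_3^*a_2^*a_1^* − a_2a_3x_4^2a_3^*a_2^* − a_3x_6x_4x_6a_3^* − x_4x_3^2x_4 − a_4x_4x_6x_4a_4^* + a_6x_4x_6x_4a_6^* lies in the center of Π(E_7), i.e. z_8·y = y·z_8 for all y ∈ Π(E_7). -/

import Mathlib

/-- Generators of the preprojective algebra of `E₇`: idempotents `e i` for the seven
vertices, arrows `a i` and reversed arrows `astar i` for the six edges. -/
inductive E7Gen : Type
  | e : Fin 7 → E7Gen
  | a : Fin 6 → E7Gen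
  | astar : Fin 6 → E7Gen

namespace E7

/-- The trivial-path generators inside the free algebra. -/
noncomputable def E (i : Fin 7) : FreeAlgebra ℂ E7Gen := FreeAlgebra.ι ℂ (E7Gen.e i)

/-- The arrow generators inside the free algebra. -/
noncomputable def A (i : Fin 6) : FreeAlgebra ℂ E7Gen := FreeAlgebra.ι ℂ (E7Gen.a i)

/-- The reversed-arrow generators inside the free algebra. -/
noncomputable def S (i : Fin 6) : FreeAlgebra ℂ E7Gen := FreeAlgebra.ι ℂ (E7Gen.astar i)

/-- Sources of the arrows `a₁ : 1 → 2`, `a₂ : 2 → 3`, `a₃ : 3 → 4`, `a₄ : 5 → 4`,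
`a₅ : 6 → 5`, `a₆ : 7 → 4` (vertices are `0`-indexed). -/
def src : Fin 6 → Fin 7 := ![0, 1, 2, 4, 5, 6]

/-- Targets of the arrows of the `E₇` quiver (vertices are `0`-indexed). -/
def tgt : Fin 6 → Fin 7 := ![1, 2, 3, 3, 4, 3]

/-- The defining relations of the preprojective algebra `Π(E₇)`. -/
inductive Rel : FreeAlgebra ℂ E7Gen → FreeAlgebra ℂ E7Gen → Prop
  | orth (i j : Fin 7) : Rel (E i * E j) (if i = j then E i else 0)
  | sum_eq_one : Rel (∑ i, E i) 1
  | arrow_left (i : Fin 6) : Rel (E (src i) * A i) (A i)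
  | arrow_right (i : Fin 6) : Rel (A i * E (tgt i)) (A i)
  | star_left (i : Fin 6) : Rel (E (tgt i) * S i) (S i)
  | star_right (i : Fin 6) : Rel (S i * E (src i)) (S i)
  | preproj : Rel (∑ i, (A i * S i - S i * A i)) 0

end E7

/-- The preprojective algebra `Π(E₇)`: the quotient of the free `ℂ`-algebra on the
generators by the two-sided ideal generated by the defining relations. -/
abbrev PiE7 : Type := RingQuot E7.Rel

/-- The arrow `aᵢ` in `Π(E₇)` (`0`-indexed: `pa 0 = a₁`, …, `pa 5 = a₆`). -/
noncomputable def pa (i : Fin 6) : PiE7 := RingQuot.mkAlgHom ℂ E7.Rel (E7.A i)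

/-- The reversed arrow `aᵢ*` in `Π(E₇)` (`0`-indexed). -/
noncomputable def ps (i : Fin 6) : PiE7 := RingQuot.mkAlgHom ℂ E7.Rel (E7.S i)

/-- The element `xᵢ = aᵢ* aᵢ` in `Π(E₇)` (`0`-indexed: `px 0 = x₁`, …, `px 5 = x₆`). -/
noncomputable def px (i : Fin 6) : PiE7 := ps i * pa i

/-- `z₈ = −a₁a₂a₃x₆a₃*a₂*a₁* − a₂a₃x₄²a₃*a₂* − a₃x₆x₄x₆a₃* − x₄x₃²x₄ − a₄x₄x₆x₄a₄*
    + a₆x₄x₆x₄a₆*`. -/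
noncomputable def z8 : PiE7 :=
  -(pa 0 * pa 1 * pa 2 * px 5 * ps 2 * ps 1 * ps 0) - pa 1 * pa 2 * px 3 ^ 2 * ps 2 * ps 1
    - pa 2 * px 5 * px 3 * px 5 * ps 2 - px 3 * px 2 ^ 2 * px 3
    - pa 3 * px 3 * px 5 * px 3 * ps 3 + pa 5 * px 3 * px 5 * px 3 * ps 5

/-- `z₁₂ = −a₃x₄x₆x₄x₆x₄a₃* − x₄x₆x₄²x₆x₄ + a₄x₆x₄x₆x₄x₆a₄* + a₆x₄x₆x₄x₆x₄a₆*`. -/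
noncomputable def z12 : PiE7 :=
  -(pa 2 * px 3 * px 5 * px 3 * px 5 * px 3 * ps 2) - px 3 * px 5 * px 3 ^ 2 * px 5 * px 3
    + pa 3 * px 5 * px 3 * px 5 * px 3 * px 5 * ps 3
    + pa 5 * px 3 * px 5 * px 3 * px 5 * px 3 * ps 5

namespace E7

/-- The vertexwise form of the preprojective relations of type `E₇`, for two families of
elements of a ring. -/
structure VertexRels {R : Type*} [Ring R] (a s : Fin 6 → R) : Prop where
  v1 : a 0 * s 0 = 0
  v2 : a 1 * s 1 = s 0 * a 0
  v3 : a 2 * s 2 = s 1 * a 1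
  v4 : s 2 * a 2 + s 3 * a 3 + s 5 * a 5 = 0
  v5 : a 3 * s 3 = s 4 * a 4
  v6 : a 4 * s 4 = 0
  v7 : a 5 * s 5 = 0

/-- The components of `z₈` at the seven vertices, for two families of elements of a ring. -/
def zComp {R : Type*} [Ring R] (a s : Fin 6 → R) : Fin 7 → R :=
  ![-(a 0 * a 1 * a 2 * (s 5 * a 5) * s 2 * s 1 * s 0),
    -(a 1 * a 2 * (s 3 * a 3) ^ 2 * s 2 * s 1),
    -(a 2 * (s 5 * a 5) * (s 3 * a 3) * (s 5 * a 5) * s 2),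
    -((s 3 * a 3) * (s 2 * a 2) ^ 2 * (s 3 * a 3)),
    -(a 3 * (s 3 * a 3) * (s 5 * a 5) * (s 3 * a 3) * s 3),
    0,
    a 5 * (s 3 * a 3) * (s 5 * a 5) * (s 3 * a 3) * s 5]

section

variable {R : Type*} [Ring R] {a s : Fin 6 → R} {p : Fin 7 → R}

theorem mul_zComp (ha : ∀ v i, p v * a i = if v = src i then a i else 0)
    (hs : ∀ v i, p v * s i = if v = tgt i then s i else 0) (u v : Fin 7) :
    p u * zComp a s v = if u = v then zComp a s v else 0 := by
  fin_cases v <;> fin_cases u <;> simp [zComp, ← mul_assoc, ha, hs, src, tgt]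

theorem zComp_mul (hs : ∀ i v, s i * p v = if v = src i then s i else 0)
    (ha : ∀ i v, a i * p v = if v = tgt i then a i else 0) (u v : Fin 7) :
    zComp a s v * p u = if u = v then zComp a s v else 0 := by
  fin_cases v <;> fin_cases u <;> simp [zComp, mul_assoc, hs, ha, src, tgt]

end

namespace VertexRels

variable {R : Type*} [Ring R] {a s : Fin 6 → R}

theorem of_sum (h : ∀ v, ∑ i, ((if v = src i then a i * s i else 0) -
    (if v = tgt i then s i * a i else 0)) = 0) : VertexRels a s := by
  simp only [Fin.sum_univ_six, src, tgt] at h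
  constructor
  · simpa using h 0
  · exact (neg_add_eq_zero.mp (by simpa using h 1)).symm
  · exact (neg_add_eq_zero.mp (by simpa using h 2)).symm
  · have := h 3
    simp [-neg_add_rev] at this
    rw [← neg_eq_zero, ← this]
    abel
  · exact sub_eq_zero.mp (by simpa [sub_eq_add_neg] using h 4)
  · simpa using h 5
  · simpa using h 6

theorem op (h : VertexRels a s) :
    VertexRels (fun i => MulOpposite.op (s i)) (fun i => MulOpposite.op (a i)) where
  v1 := by rw [← MulOpposite.op_mul, h.v1, MulOpposite.op_zero]
  v2 := by rw [← MulOpposite.op_mul, h.v2, MulOpposite.op_mul]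
  v3 := by rw [← MulOpposite.op_mul, h.v3, MulOpposite.op_mul]
  v4 := by simp only [← MulOpposite.op_mul, ← MulOpposite.op_add, h.v4, MulOpposite.op_zero]
  v5 := by rw [← MulOpposite.op_mul, h.v5, MulOpposite.op_mul]
  v6 := by rw [← MulOpposite.op_mul, h.v6, MulOpposite.op_zero]
  v7 := by rw [← MulOpposite.op_mul, h.v7, MulOpposite.op_zero]

theorem zComp_op (a s : Fin 6 → R) (v : Fin 7) :
    zComp (fun i => MulOpposite.op (s i)) (fun i => MulOpposite.op (a i)) v =
      MulOpposite.op (zComp a s v) := by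
  fin_cases v <;> simp [zComp, mul_assoc, pow_two]

/-- The components of `z₈` at the two ends of an arrow are intertwined by that arrow. -/
theorem zComp_mul_arrow (h : VertexRels a s) (i : Fin 6) :
    zComp a s (src i) * a i = a i * zComp a s (tgt i) := by
  obtain ⟨h1, h2, h3, h4, h5, h6, h7⟩ := h
  obtain ⟨w, hw⟩ : ∃ w, w = s 2 * a 2 := ⟨_, rfl⟩
  obtain ⟨x, hx⟩ : ∃ x, x = s 3 * a 3 := ⟨_, rfl⟩
  obtain ⟨y, hy⟩ : ∃ y, y = s 5 * a 5 := ⟨_, rfl⟩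
  rw [← hw, ← hx, ← hy] at h4
  have a5y : a 5 * y = 0 := by rw [hy, ← mul_assoc, h7, zero_mul]
  have yy : y * y = 0 := by
    rw [show y * y = s 5 * (a 5 * y) by rw [← mul_assoc, ← hy], a5y, mul_zero]
  have a3x : a 3 * x = s 4 * a 4 * a 3 := by rw [hx, ← mul_assoc, h5]
  have a43x : a 4 * a 3 * x = 0 := by
    linear_combination (norm := noncomm_ring) a 4 * a3x + h6 * (a 4 * a 3)
  have a3xx : a 3 * x * x = 0 := by
    linear_combination (norm := noncomm_ring) a3x * x + s 4 * a43x
  have xxx : x * x * x = 0 := by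
    linear_combination (norm := noncomm_ring) s 3 * a3xx + hx * x * x
  have a2w : a 2 * w = s 1 * a 1 * a 2 := by rw [hw, ← mul_assoc, h3]
  have a12w : a 1 * a 2 * w = s 0 * a 0 * a 1 * a 2 := by
    linear_combination (norm := noncomm_ring) a 1 * a2w + h2 * (a 1 * a 2)
  have a012w : a 0 * a 1 * a 2 * w = 0 := by
    linear_combination (norm := noncomm_ring) a 0 * a12w + h1 * (a 0 * a 1 * a 2)
  have a12ww : a 1 * a 2 * w * w = 0 := by
    linear_combination (norm := noncomm_ring) a12w * w + s 0 * a012w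
  have a2www : a 2 * w * w * w = 0 := by
    linear_combination (norm := noncomm_ring) a2w * w * w + s 1 * a12ww
  have wwww : w * w * w * w = 0 := by
    linear_combination (norm := noncomm_ring) s 2 * a2www + hw * w * w * w
  have ws : w * s 2 = s 2 * s 1 * a 1 := by rw [hw, mul_assoc, h3, mul_assoc]
  have wss : w * s 2 * s 1 = s 2 * s 1 * s 0 * a 0 := by
    linear_combination (norm := noncomm_ring) ws * s 1 + s 2 * s 1 * h2
  have hw' : w = -(x + y) := by linear_combination (norm := noncomm_ring) h4
  fin_cases i <;> simp only [zComp, src, tgt, ← hw, ← hx, ← hy] <;> simp only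
    [Fin.mk_zero, Fin.mk_one, Fin.reduceFinMk, Matrix.cons_val]
  · have key : a 0 * a 1 * a 2 * (y * w - x * x) = 0 := by
      subst hw'
      linear_combination (norm := noncomm_ring) a012w * x - a 0 * a 1 * a 2 * yy
    linear_combination (norm := noncomm_ring) a 0 * a 1 * a 2 * y * wss - key * s 2 * s 1
  · have key : a 1 * a 2 * (x * x * w - y * x * y) = 0 := by
      subst hw'
      linear_combination (norm := noncomm_ring)
        -(a12ww * y) - a 1 * a 2 * xxx + a 1 * a 2 * (x * yy + y * yy)
    linear_combination (norm := noncomm_ring) a 1 * a 2 * x * x * ws - key * s 2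
  · have key : a 2 * (y * x * y * w - x * w * w * x) = 0 := by
      subst hw'
      linear_combination (norm := noncomm_ring)
        a2www * x + a 2 * (y * xxx + yy * x * x + yy * y * x - y * x * yy)
    linear_combination (norm := noncomm_ring) a 2 * y * x * y * hw - key
  · have key : a 3 * (x * y * x * x - x * w * w * x) = 0 := by
      subst hw'
      linear_combination (norm := noncomm_ring)
        -(a3xx * x * x) - a3xx * y * x - a 3 * x * yy * x
    linear_combination (norm := noncomm_ring) a 3 * x * y * x * hx - key
  · linear_combination (norm := noncomm_ring) a43x * y * x * s 3
  · have key : a 5 * (x * y * x * y + x * w * w * x) = 0 := by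
      subst hw'
      linear_combination (norm := noncomm_ring)
        a 5 * wwww - a5y * (x + y) * (x + y) * (x + y) - a 5 * (xxx * y + x * x * yy + x * yy * y)
    linear_combination (norm := noncomm_ring) key - a 5 * x * y * x * hy

theorem star_mul_zComp (h : VertexRels a s) (i : Fin 6) :
    s i * zComp a s (src i) = zComp a s (tgt i) * s i := by
  have := h.op.zComp_mul_arrow i
  rw [zComp_op, zComp_op, ← MulOpposite.op_mul, ← MulOpposite.op_mul] at this
  exact MulOpposite.op_injective this

end VertexRels

/-- The vertex idempotents in `Π(E₇)`. -/
noncomputable def pe (i : Fin 7) : PiE7 := RingQuot.mkAlgHom ℂ Rel (E i)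

theorem pe_mul_pe (i j : Fin 7) : pe i * pe j = if i = j then pe i else 0 := by
  have := RingQuot.mkAlgHom_rel ℂ (Rel.orth i j)
  rw [map_mul] at this
  split_ifs at this ⊢ <;> simpa [pe] using this

theorem pe_mul_pa (i : Fin 6) : pe (src i) * pa i = pa i := by
  simpa [pe, pa] using RingQuot.mkAlgHom_rel ℂ (Rel.arrow_left i)

theorem pa_mul_pe (i : Fin 6) : pa i * pe (tgt i) = pa i := by
  simpa [pe, pa] using RingQuot.mkAlgHom_rel ℂ (Rel.arrow_right i)

theorem pe_mul_ps (i : Fin 6) : pe (tgt i) * ps i = ps i := by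
  simpa [pe, ps] using RingQuot.mkAlgHom_rel ℂ (Rel.star_left i)

theorem ps_mul_pe (i : Fin 6) : ps i * pe (src i) = ps i := by
  simpa [pe, ps] using RingQuot.mkAlgHom_rel ℂ (Rel.star_right i)

theorem pe_mul_pa' (v : Fin 7) (i : Fin 6) :
    pe v * pa i = if v = src i then pa i else 0 := by
  rw [← pe_mul_pa, ← mul_assoc, pe_mul_pe]
  split_ifs with hv <;> simp [hv]

theorem pe_mul_ps' (v : Fin 7) (i : Fin 6) :
    pe v * ps i = if v = tgt i then ps i else 0 := by
  rw [← pe_mul_ps, ← mul_assoc, pe_mul_pe]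
  split_ifs with hv <;> simp [hv]

theorem ps_mul_pe' (i : Fin 6) (v : Fin 7) :
    ps i * pe v = if v = src i then ps i else 0 := by
  rw [← ps_mul_pe, mul_assoc, pe_mul_pe]
  split_ifs with h₁ h₂ h₂ <;> simp_all

theorem pa_mul_pe' (i : Fin 6) (v : Fin 7) :
    pa i * pe v = if v = tgt i then pa i else 0 := by
  rw [← pa_mul_pe, mul_assoc, pe_mul_pe]
  split_ifs with h₁ h₂ h₂ <;> simp_all

theorem sum_preproj_vertex (v : Fin 7) :
    ∑ i, ((if v = src i then pa i * ps i else 0) -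
      (if v = tgt i then ps i * pa i else 0)) = 0 := by
  have := RingQuot.mkAlgHom_rel ℂ Rel.preproj
  simp only [map_sum, map_sub, map_mul, map_zero] at this
  refine Eq.trans ?_ ((congrArg (pe v * ·) this).trans (mul_zero _))
  rw [Finset.mul_sum]
  refine Finset.sum_congr rfl fun i _ => ?_
  rw [mul_sub]
  change _ = pe v * (pa i * ps i) - pe v * (ps i * pa i)
  rw [← mul_assoc, ← mul_assoc, pe_mul_pa', pe_mul_ps', ite_mul, ite_mul, zero_mul, zero_mul]

theorem vertexRels : VertexRels pa ps := .of_sum sum_preproj_vertex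

theorem z8_eq_sum_zComp : z8 = ∑ v, zComp pa ps v := by
  simp only [Fin.sum_univ_seven, zComp, Matrix.cons_val, z8, px]
  abel

theorem pe_mul_zComp (u v : Fin 7) :
    pe u * zComp pa ps v = if u = v then zComp pa ps v else 0 :=
  mul_zComp pe_mul_pa' pe_mul_ps' u v

theorem zComp_mul_pe (u v : Fin 7) :
    zComp pa ps v * pe u = if u = v then zComp pa ps v else 0 :=
  zComp_mul ps_mul_pe' pa_mul_pe' u v

theorem pe_mul_z8 (v : Fin 7) : pe v * z8 = zComp pa ps v := by
  simp [z8_eq_sum_zComp, Finset.mul_sum, pe_mul_zComp]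

theorem z8_mul_pe (v : Fin 7) : z8 * pe v = zComp pa ps v := by
  simp [z8_eq_sum_zComp, Finset.sum_mul, zComp_mul_pe]

theorem z8_mul_pa (i : Fin 6) : z8 * pa i = pa i * z8 := by
  rw [← pe_mul_pa, ← mul_assoc, z8_mul_pe, vertexRels.zComp_mul_arrow, pe_mul_pa, ← pe_mul_z8,
    ← mul_assoc, pa_mul_pe]

theorem z8_mul_ps (i : Fin 6) : z8 * ps i = ps i * z8 := by
  rw [← pe_mul_ps, ← mul_assoc, z8_mul_pe, ← vertexRels.star_mul_zComp, pe_mul_ps, ← pe_mul_z8,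
    ← mul_assoc, ps_mul_pe]

end E7

/-- The element `z₈` lies in the center of the preprojective algebra `Π(E₇)`. -/
theorem z8_mem_center : ∀ y : PiE7, z8 * y = y * z8 := by
  intro y
  obtain ⟨y, rfl⟩ := RingQuot.mkAlgHom_surjective ℂ E7.Rel y
  induction y using FreeAlgebra.induction with
  | grade0 r => rw [AlgHom.commutes, Algebra.commutes]
  | grade1 g =>
    cases g with
    | e v => exact (E7.z8_mul_pe v).trans (E7.pe_mul_z8 v).symm
    | a i => exact E7.z8_mul_pa i
    | astar i => exact E7.z8_mul_ps i
  | mul b c hb hc => rw [map_mul, ← mul_assoc, hb, mul_assoc, hc, mul_assoc]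
  | add b c hb hc => rw [map_add, mul_add, add_mul, hb, hc]
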